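/- Let m ≥ 0 be an integer and define M₀(t,s) = G(t,s)·G(1,1) − G(t,1)·G(1,s). Then for all 0 < s < t < 1 one has M₀(t,s) < √(M₀(t,t)·M₀(s,s)); in particular M₀(t,s) < max{M₀(t,t), M₀(s,s)}, so M₀ attains its maximum over [0,1]×[0,1] on the diagonal. -/

import Mathlib

open MeasureTheory intervalIntegral

/-- Green function of the focal boundary value problem. -/
noncomputable def greenG (m : ℕ) (t s : ℝ) : ℝ :=
  (1 / ((Nat.factorial m : ℝ))^2) * ∫ τ in (0:ℝ)..(min s t), (t - τ)^m * (s - τ)^m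

/-- M₀(t,s) = G(t,s)·G(1,1) − G(t,1)·G(1,s). -/
noncomputable def funcM0 (m : ℕ) (t s : ℝ) : ℝ :=
  greenG m t s * greenG m 1 1 - greenG m t 1 * greenG m 1 s

/-- The truncated power `(t - τ)₊ ^ m`. -/
noncomputable def truncPow (m : ℕ) (t : ℝ) : ℝ → ℝ :=
  Set.indicator {τ | τ ≤ t} fun τ => (t - τ) ^ m

theorem truncPow_of_le {m : ℕ} {t τ : ℝ} (h : τ ≤ t) : truncPow m t τ = (t - τ) ^ m :=
  Set.indicator_of_mem (s := {τ | τ ≤ t}) h _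

theorem truncPow_of_lt {m : ℕ} {t τ : ℝ} (h : t < τ) : truncPow m t τ = 0 :=
  Set.indicator_of_notMem (s := {τ | τ ≤ t}) (not_le.mpr h) _

theorem truncPow_mul_truncPow (m : ℕ) (t s : ℝ) :
    (fun τ => truncPow m t τ * truncPow m s τ) =
      Set.indicator {τ | τ ≤ min s t} fun τ => (t - τ) ^ m * (s - τ) ^ m := by
  funext τ
  simp only [truncPow, Set.indicator, Set.mem_ofPred_eq, le_min_iff]
  split_ifs <;> simp_all

theorem intervalIntegrable_truncPow_mul (m : ℕ) (t s a b : ℝ) :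
    IntervalIntegrable (fun τ => truncPow m t τ * truncPow m s τ) volume a b := by
  have h : Continuous fun τ : ℝ => (t - τ) ^ m * (s - τ) ^ m := by fun_prop
  rw [truncPow_mul_truncPow]
  exact ⟨(h.intervalIntegrable a b).1.indicator measurableSet_Iic,
    (h.intervalIntegrable a b).2.indicator measurableSet_Iic⟩

theorem greenG_eq_integral_truncPow (m : ℕ) {t s : ℝ} (ht : t ∈ Set.Icc (0 : ℝ) 1)
    (hs : s ∈ Set.Icc (0 : ℝ) 1) :
    greenG m t s =
      1 / (Nat.factorial m : ℝ) ^ 2 * ∫ τ in (0 : ℝ)..1, truncPow m t τ * truncPow m s τ := by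
  rw [greenG, truncPow_mul_truncPow, intervalIntegral.integral_indicator]
  exact ⟨le_min hs.1 ht.1, (min_le_left _ _).trans hs.2⟩

theorem greenG_comm (m : ℕ) (t s : ℝ) : greenG m t s = greenG m s t := by
  simp only [greenG, min_comm s t, mul_comm ((t - _) ^ m)]

theorem continuous_greenG (m : ℕ) : Continuous fun p : ℝ × ℝ => greenG m p.1 p.2 := by
  refine continuous_const.mul ?_
  exact intervalIntegral.continuous_parametric_intervalIntegral_of_continuous
    (f := fun (p : ℝ × ℝ) τ => (p.1 - τ) ^ m * (p.2 - τ) ^ m) (by fun_prop) (by fun_prop)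

/-- The square of a linear combination of three truncated powers. -/
noncomputable def truncPowCombSq (m : ℕ) (t s a b d : ℝ) (τ : ℝ) : ℝ :=
  (a * truncPow m t τ + b * truncPow m s τ + d * truncPow m 1 τ) ^ 2

theorem truncPowCombSq_eq (m : ℕ) (t s a b d : ℝ) :
    truncPowCombSq m t s a b d = fun τ =>
      a ^ 2 * (truncPow m t τ * truncPow m t τ) + b ^ 2 * (truncPow m s τ * truncPow m s τ) +
      d ^ 2 * (truncPow m 1 τ * truncPow m 1 τ) + 2 * a * b * (truncPow m t τ * truncPow m s τ) +
      2 * a * d * (truncPow m t τ * truncPow m 1 τ) +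
      2 * b * d * (truncPow m s τ * truncPow m 1 τ) := by
  funext τ
  simp only [truncPowCombSq]
  ring

theorem intervalIntegrable_truncPowCombSq (m : ℕ) (t s a b d x y : ℝ) :
    IntervalIntegrable (truncPowCombSq m t s a b d) volume x y := by
  have h := fun u v c => (intervalIntegrable_truncPow_mul m u v x y).const_mul c
  rw [truncPowCombSq_eq]
  exact (((((h _ _ _).add (h _ _ _)).add (h _ _ _)).add (h _ _ _)).add (h _ _ _)).add (h _ _ _)

theorem integral_truncPowCombSq (m : ℕ) {t s : ℝ} (ht : t ∈ Set.Icc (0 : ℝ) 1)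
    (hs : s ∈ Set.Icc (0 : ℝ) 1) (a b d : ℝ) :
    1 / (Nat.factorial m : ℝ) ^ 2 * ∫ τ in (0 : ℝ)..1, truncPowCombSq m t s a b d τ =
      a ^ 2 * greenG m t t + b ^ 2 * greenG m s s + d ^ 2 * greenG m 1 1 +
      2 * a * b * greenG m t s + 2 * a * d * greenG m t 1 + 2 * b * d * greenG m s 1 := by
  have h := fun u v c => (intervalIntegrable_truncPow_mul m u v 0 1).const_mul c
  have h1 : (1 : ℝ) ∈ Set.Icc (0 : ℝ) 1 := by simp
  rw [truncPowCombSq_eq,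
    integral_add (((((h _ _ _).add (h _ _ _)).add (h _ _ _)).add (h _ _ _)).add (h _ _ _))
      (h _ _ _),
    integral_add ((((h _ _ _).add (h _ _ _)).add (h _ _ _)).add (h _ _ _)) (h _ _ _),
    integral_add (((h _ _ _).add (h _ _ _)).add (h _ _ _)) (h _ _ _),
    integral_add ((h _ _ _).add (h _ _ _)) (h _ _ _),
    integral_add (h _ _ _) (h _ _ _)]
  simp only [intervalIntegral.integral_const_mul, greenG_eq_integral_truncPow m, ht, hs, h1]
  ring

theorem integral_pos_of_nonneg_of_pos_on_Ioo {f : ℝ → ℝ} {a b p q : ℝ} (hap : a ≤ p) (hpq : p < q)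
    (hqb : q ≤ b) (hf : ∀ x y, IntervalIntegrable f volume x y) (h0 : ∀ x, 0 ≤ f x)
    (hpos : ∀ x ∈ Set.Ioo p q, 0 < f x) : 0 < ∫ x in a..b, f x :=
  (intervalIntegral_pos_of_pos_on (hf p q) hpos hpq).trans_le <|
    integral_mono_interval hap hpq.le hqb (Filter.Eventually.of_forall h0) (hf a b)

theorem integral_truncPowCombSq_pos (m : ℕ) {t s a b d : ℝ} (hs : 0 < s) (hst : s < t) (ht : t < 1)
    (h : a ≠ 0 ∨ b ≠ 0 ∨ d ≠ 0) :
    0 < ∫ τ in (0 : ℝ)..1, truncPowCombSq m t s a b d τ := by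
  have hi := intervalIntegrable_truncPowCombSq m t s a b d
  have h0 : ∀ τ, 0 ≤ truncPowCombSq m t s a b d τ := fun τ => sq_nonneg _
  by_cases hd : d = 0
  · by_cases ha : a = 0
    · have hb : b ≠ 0 := by tauto
      refine integral_pos_of_nonneg_of_pos_on_Ioo le_rfl hs (hst.trans ht).le hi h0 fun τ hτ => ?_
      have : s - τ ≠ 0 := (sub_pos.mpr hτ.2).ne'
      rw [truncPowCombSq, truncPow_of_le hτ.2.le, ha, hd]
      simp only [zero_mul, zero_add, add_zero]
      positivity
    · refine integral_pos_of_nonneg_of_pos_on_Ioo hs.le hst ht.le hi h0 fun τ hτ => ?_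
      have : t - τ ≠ 0 := (sub_pos.mpr hτ.2).ne'
      rw [truncPowCombSq, truncPow_of_le hτ.2.le, truncPow_of_lt hτ.1, hd]
      simp only [zero_mul, mul_zero, add_zero]
      positivity
  · refine integral_pos_of_nonneg_of_pos_on_Ioo (hs.trans hst).le ht le_rfl hi h0 fun τ hτ => ?_
    have : 1 - τ ≠ 0 := (sub_pos.mpr hτ.2).ne'
    rw [truncPowCombSq, truncPow_of_le hτ.2.le, truncPow_of_lt hτ.1,
      truncPow_of_lt (hst.trans hτ.1)]
    simp only [mul_zero, zero_add]
    positivity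

theorem greenG_one_one_pos (m : ℕ) : 0 < greenG m 1 1 := by
  have h := integral_truncPowCombSq m (t := 1 / 2) (s := 1 / 3) (by norm_num) (by norm_num) 0 0 1
  have hp := integral_truncPowCombSq_pos m (t := 1 / 2) (s := 1 / 3) (a := 0) (b := 0) (d := 1)
    (by norm_num) (by norm_num) (by norm_num) (by norm_num)
  have : 0 < (Nat.factorial m : ℝ) := by positivity
  have hc := mul_pos (by positivity : 0 < 1 / (Nat.factorial m : ℝ) ^ 2) hp
  rw [h] at hc
  simpa using hc

/-- Up to a positive factor, the quadratic form of `funcM0` is that of the components of the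
truncated powers orthogonal to `truncPow m 1`. -/
theorem funcM0_quadraticForm (m : ℕ) {t s : ℝ} (ht : t ∈ Set.Icc (0 : ℝ) 1)
    (hs : s ∈ Set.Icc (0 : ℝ) 1) (a b : ℝ) :
    a ^ 2 * funcM0 m t t + 2 * a * b * funcM0 m t s + b ^ 2 * funcM0 m s s =
      greenG m 1 1 * (1 / (Nat.factorial m : ℝ) ^ 2 * ∫ τ in (0 : ℝ)..1,
        truncPowCombSq m t s a b
          (-(a * greenG m t 1 + b * greenG m s 1) / greenG m 1 1) τ) := by
  have hK := (greenG_one_one_pos m).ne'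
  rw [integral_truncPowCombSq m ht hs]
  simp only [funcM0, greenG_comm m 1 t, greenG_comm m 1 s]
  field_simp
  ring

theorem funcM0_quadraticForm_nonneg (m : ℕ) {t s : ℝ} (ht : t ∈ Set.Icc (0 : ℝ) 1)
    (hs : s ∈ Set.Icc (0 : ℝ) 1) (a b : ℝ) :
    0 ≤ a ^ 2 * funcM0 m t t + 2 * a * b * funcM0 m t s + b ^ 2 * funcM0 m s s := by
  rw [funcM0_quadraticForm m ht hs]
  exact mul_nonneg (greenG_one_one_pos m).le <| mul_nonneg (by positivity) <|
    integral_nonneg zero_le_one fun τ _ => sq_nonneg _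

theorem funcM0_quadraticForm_pos (m : ℕ) {t s a b : ℝ} (hs : 0 < s) (hst : s < t) (ht : t < 1)
    (h : a ≠ 0 ∨ b ≠ 0) :
    0 < a ^ 2 * funcM0 m t t + 2 * a * b * funcM0 m t s + b ^ 2 * funcM0 m s s := by
  rw [funcM0_quadraticForm m ⟨(hs.trans hst).le, ht.le⟩ ⟨hs.le, (hst.trans ht).le⟩]
  exact mul_pos (greenG_one_one_pos m) <| mul_pos (by positivity) <|
    integral_truncPowCombSq_pos m hs hst ht (by tauto)

theorem continuous_funcM0_diag (m : ℕ) : Continuous fun t => funcM0 m t t := by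
  have h := continuous_greenG m
  have h1 : Continuous fun t => greenG m t t := h.comp (continuous_id.prodMk continuous_id)
  have h2 : Continuous fun t => greenG m t 1 := h.comp (continuous_id.prodMk continuous_const)
  have h3 : Continuous fun t => greenG m 1 t := h.comp (continuous_const.prodMk continuous_id)
  exact (h1.mul continuous_const).sub (h2.mul h3)

theorem funcM0_max_on_diagonal (m : ℕ) :
    (∀ s t : ℝ, 0 < s → s < t → t < 1 →
      funcM0 m t s < Real.sqrt (funcM0 m t t * funcM0 m s s) ∧
      funcM0 m t s < max (funcM0 m t t) (funcM0 m s s)) ∧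
    ∃ t₀ ∈ Set.Icc (0:ℝ) 1, ∀ t ∈ Set.Icc (0:ℝ) 1, ∀ s ∈ Set.Icc (0:ℝ) 1,
      funcM0 m t s ≤ funcM0 m t₀ t₀ := by
  constructor
  · intro s t hs hst ht
    have hQ := fun a b => funcM0_quadraticForm_pos m (a := a) (b := b) hs hst ht
    have hC : 0 < funcM0 m s s := by simpa using hQ 0 1 (by simp)
    constructor
    · apply Real.lt_sqrt_of_sq_lt
      have h := hQ (funcM0 m s s) (-funcM0 m t s) (Or.inl hC.ne')
      have h' : 0 < funcM0 m s s * (funcM0 m t t * funcM0 m s s - funcM0 m t s ^ 2) := by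
        linarith
      exact sub_pos.mp (pos_of_mul_pos_right h' hC.le)
    · have h := hQ 1 (-1) (by simp)
      linarith [le_max_left (funcM0 m t t) (funcM0 m s s),
        le_max_right (funcM0 m t t) (funcM0 m s s)]
  · obtain ⟨t₀, ht₀, hmax⟩ := isCompact_Icc.exists_isMaxOn (Set.nonempty_Icc.mpr zero_le_one)
      (continuous_funcM0_diag m).continuousOn
    refine ⟨t₀, ht₀, fun t ht s hs => ?_⟩
    have h := funcM0_quadraticForm_nonneg m ht hs 1 (-1)
    have h1 : funcM0 m t t ≤ funcM0 m t₀ t₀ := hmax ht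
    have h2 : funcM0 m s s ≤ funcM0 m t₀ t₀ := hmax hs
    linarith
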